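/- For d = 8, the Poincaré series of the algebra of covariants of the binary 8-form satisfies P_8(z) = p_8(z)/((1 − z)(1 − z²)²(1 − z³)²(1 − z⁴)(1 − z⁵)(1 − z⁷)), where p_8(z) = z^{18} + 2z^{16} + 6z^{15} + 12z^{14} + 19z^{13} + 25z^{12} + 31z^{11} + 36z^{10} + 38z^9 + 36z^8 + 31z^7 + 25z^6 + 19z^5 + 12z^4 + 6z^3 + 2z^2 + 1; i.e. ∑_{n≥0} dim(S_n) z^n = p_8(z) · ((1 − z)(1 − z²)²(1 − z³)²(1 − z⁴)(1 − z⁵)(1 − z⁷))^{−1} in ℂ[[z]]. -/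

import Mathlib

noncomputable section

/-- The derivation D₁ on ℂ[x_0,…,x_d] with D₁(x_0)=0 and D₁(x_i)=i·x_{i-1}
(for i = 0 the coefficient i vanishes, so the wrap-around in `Fin` is harmless). -/
def D1 (d : ℕ) :
    Derivation ℂ (MvPolynomial (Fin (d + 1)) ℂ) (MvPolynomial (Fin (d + 1)) ℂ) :=
  MvPolynomial.mkDerivation ℂ (fun i => (i.val : ℂ) • MvPolynomial.X (i - 1))

/-- S_n: the space of homogeneous degree-n seminvariants of the binary d-form. -/
def Sn (d n : ℕ) : Submodule ℂ (MvPolynomial (Fin (d + 1)) ℂ) :=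
  MvPolynomial.homogeneousSubmodule (Fin (d + 1)) ℂ n ⊓ LinearMap.ker (D1 d).toLinearMap

/-- The Poincaré series P_d(z) = ∑_{n≥0} dim(S_n) zⁿ of the algebra of covariants. -/
def PSeries (d : ℕ) : PowerSeries ℂ :=
  PowerSeries.mk fun n => (Module.finrank ℂ (Sn d n) : ℂ)

open MvPolynomial in
/-- The raising operator opposite to `D1`. -/
def raising (d : ℕ) :
    Derivation ℂ (MvPolynomial (Fin (d + 1)) ℂ) (MvPolynomial (Fin (d + 1)) ℂ) :=
  mkDerivation ℂ (fun i => ((d : ℂ) - i.val) • X (i + 1))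

/-- The bidegree of the variable `x_i`: its degree and its `sl₂`-weight. -/
def biweight (d : ℕ) (i : Fin (d + 1)) : ℤ × ℤ := (1, 2 * i.val - d)

open MvPolynomial in
theorem isWeightedHomogeneous_derivation {σ : Type*} {w : σ → ℤ × ℤ} {δ : ℤ × ℤ}
    (D : Derivation ℂ (MvPolynomial σ ℂ) (MvPolynomial σ ℂ))
    (hD : ∀ i, IsWeightedHomogeneous w (D (X i)) (w i + δ))
    {p : MvPolynomial σ ℂ} {m : ℤ × ℤ} (hp : IsWeightedHomogeneous w p m) :
    IsWeightedHomogeneous w (D p) (m + δ) := by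
  rw [p.as_sum, map_sum]
  refine IsWeightedHomogeneous.sum _ _ _ fun s hs => ?_
  have hDeq : D = mkDerivation ℂ fun i => D (X i) := by
    ext i : 1
    simp
  rw [hDeq, mkDerivation_monomial, ← mem_weightedHomogeneousSubmodule]
  refine Submodule.smul_mem _ _ (Submodule.sum_mem _ fun i hi => ?_)
  rw [mem_weightedHomogeneousSubmodule]
  beta_reduce
  rw [smul_eq_mul]
  have hs' : s - Finsupp.single i 1 + Finsupp.single i 1 = s :=
    tsub_add_cancel_of_le (by
      rw [Finsupp.single_le_iff]; exact Nat.one_le_iff_ne_zero.mpr (Finsupp.mem_support_iff.mp hi))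
  have hw : Finsupp.weight w (s - Finsupp.single i 1) + w i = m := by
    rw [← hp (mem_support_iff.mp hs)]
    conv_rhs => rw [← hs']
    simp [Finsupp.weight_single]
  have := (isWeightedHomogeneous_monomial w (s - Finsupp.single i 1) (s i : ℂ) rfl).mul (hD i)
  rwa [← add_assoc, hw] at this

open MvPolynomial in
theorem isWeightedHomogeneous_D1 {d : ℕ} {p : MvPolynomial (Fin (d + 1)) ℂ} {n h : ℤ}
    (hp : IsWeightedHomogeneous (biweight d) p (n, h)) :
    IsWeightedHomogeneous (biweight d) (D1 d p) (n, h - 2) := by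
  have := isWeightedHomogeneous_derivation (δ := (0, -2)) (D1 d) (fun i => ?_) hp
  · simpa [sub_eq_add_neg] using this
  rw [D1, mkDerivation_X, ← mem_weightedHomogeneousSubmodule]
  cases i using Fin.cases with
  | zero => simp
  | succ i =>
    refine Submodule.smul_mem _ _ ?_
    have hi : i.succ - 1 = i.castSucc := by simp [sub_eq_iff_eq_add]
    rw [hi, mem_weightedHomogeneousSubmodule]
    convert isWeightedHomogeneous_X ℂ (biweight d) i.castSucc using 1
    ext <;> simp [biweight]
    ring

open MvPolynomial in
theorem isWeightedHomogeneous_raising {d : ℕ} {p : MvPolynomial (Fin (d + 1)) ℂ} {n h : ℤ}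
    (hp : IsWeightedHomogeneous (biweight d) p (n, h)) :
    IsWeightedHomogeneous (biweight d) (raising d p) (n, h + 2) := by
  have := isWeightedHomogeneous_derivation (δ := (0, 2)) (raising d) (fun i => ?_) hp
  · simpa using this
  rw [raising, mkDerivation_X, ← mem_weightedHomogeneousSubmodule]
  cases i using Fin.lastCases with
  | last => simp
  | cast i =>
    refine Submodule.smul_mem _ _ ?_
    have hi : i.castSucc + 1 = i.succ := by simp
    rw [hi, mem_weightedHomogeneousSubmodule]
    convert isWeightedHomogeneous_X ℂ (biweight d) i.succ using 1
    ext <;> simp [biweight]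
    ring

open MvPolynomial in
theorem mkDerivation_smul_X_monomial {σ : Type*} (c : σ → ℂ) (s : σ →₀ ℕ) (r : ℂ) :
    mkDerivation ℂ (fun i => c i • (X i : MvPolynomial σ ℂ)) (monomial s r) =
      (s.sum fun i k => k * c i) • monomial s r := by
  rw [mkDerivation_monomial, Finsupp.sum, Finsupp.sum, Finset.smul_sum, Finset.sum_smul]
  refine Finset.sum_congr rfl fun i hi => ?_
  have hs' : s - Finsupp.single i 1 + Finsupp.single i 1 = s :=
    tsub_add_cancel_of_le (by
      rw [Finsupp.single_le_iff]; exact Nat.one_le_iff_ne_zero.mpr (Finsupp.mem_support_iff.mp hi))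
  rw [smul_eq_mul, mul_smul_comm, X, monomial_mul, hs', smul_monomial, smul_monomial, smul_monomial]
  congr 1
  simp
  ring

open MvPolynomial in
theorem D1_raising {d : ℕ} {p : MvPolynomial (Fin (d + 1)) ℂ} {n h : ℤ}
    (hp : IsWeightedHomogeneous (biweight d) p (n, h)) :
    D1 d (raising d p) = raising d (D1 d p) - (h : ℂ) • p := by
  have hcomm : ⁅D1 d, raising d⁆ =
      mkDerivation ℂ (fun i : Fin (d + 1) => (-(2 * (i.val : ℂ) - d)) • X i) := by
    ext i : 1
    rw [Derivation.commutator_apply, mkDerivation_X]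
    simp only [D1, raising, mkDerivation_X, Derivation.map_smul]
    rw [add_sub_cancel_right, sub_add_cancel, smul_smul, smul_smul, ← sub_smul]
    congr 1
    have h1 : ((d : ℂ) - i.val) * ((i + 1 : Fin (d + 1)).val : ℂ) = (d - i.val) * (i.val + 1) := by
      cases i using Fin.lastCases with
      | last => simp
      | cast i => simp
    have h2 : (i.val : ℂ) * (d - ((i - 1 : Fin (d + 1)).val : ℂ)) = i.val * (d - i.val + 1) := by
      cases i using Fin.cases with
      | zero => simp
      | succ i =>
        have hi : i.succ - 1 = i.castSucc := by simp [sub_eq_iff_eq_add]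
        rw [hi, Fin.val_succ, Fin.val_castSucc]
        push_cast
        ring
    rw [h1, h2]
    ring
  have hH : mkDerivation ℂ (fun i : Fin (d + 1) => (-(2 * (i.val : ℂ) - d)) • X i) p =
      (-(h : ℂ)) • p := by
    rw [p.as_sum, map_sum, Finset.smul_sum]
    refine Finset.sum_congr rfl fun s hs => ?_
    rw [mkDerivation_smul_X_monomial]
    congr 1
    have := congrArg Prod.snd (hp (mem_support_iff.mp hs))
    rw [Finsupp.weight_apply] at this
    simp only [Finsupp.sum, Prod.snd_sum] at this ⊢
    rw [← this]
    push_cast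
    rw [← Finset.sum_neg_distrib]
    refine Finset.sum_congr rfl fun i _ => ?_
    simp [biweight]
    ring
  rw [← hcomm, Derivation.commutator_apply, neg_smul] at hH
  linear_combination hH

open MvPolynomial in
theorem eq_zero_of_biweight_large {d : ℕ} {p : MvPolynomial (Fin (d + 1)) ℂ} {n h : ℤ}
    (hp : IsWeightedHomogeneous (biweight d) p (n, h)) (hh : d * n < h) : p = 0 := by
  ext s
  by_contra hs
  have := hp hs
  rw [Finsupp.weight_apply, Finsupp.sum, Prod.ext_iff, Prod.fst_sum, Prod.snd_sum] at this
  obtain ⟨h1, h2⟩ := this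
  simp only at h1 h2
  rw [← h1, ← h2, Finset.mul_sum] at hh
  refine absurd hh (not_lt.mpr (Finset.sum_le_sum fun i _ => ?_))
  have : (i : ℤ) ≤ d := by exact_mod_cast Fin.is_le i
  simp [biweight]
  nlinarith

open MvPolynomial in
theorem eq_zero_of_D1_eq_zero {d : ℕ} {p : MvPolynomial (Fin (d + 1)) ℂ} {n h : ℤ}
    (hp : IsWeightedHomogeneous (biweight d) p (n, h)) (hh : 0 < h) (hE : D1 d p = 0) : p = 0 := by
  have hom (m : ℕ) : IsWeightedHomogeneous (biweight d) ((raising d)^[m] p) (n, h + 2 * m) := by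
    induction m with
    | zero => simpa using hp
    | succ m ih =>
      rw [Function.iterate_succ_apply']
      convert isWeightedHomogeneous_raising ih using 2
      push_cast; ring
  have comm (m : ℕ) : D1 d ((raising d)^[m + 1] p) =
      (-((m + 1) * (h + m)) : ℂ) • (raising d)^[m] p := by
    induction m with
    | zero => simp [D1_raising hp, hE]
    | succ m ih =>
      rw [Function.iterate_succ_apply', D1_raising (hom _), ih, Derivation.map_smul,
        ← Function.iterate_succ_apply' (raising d), ← sub_smul]
      congr 1
      push_cast; ring
  have descend (m : ℕ) (hm : (raising d)^[m] p = 0) : p = 0 := by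
    induction m with
    | zero => exact hm
    | succ m ih =>
      refine ih ((smul_eq_zero.mp ((comm m).symm.trans (by rw [hm, map_zero]))).resolve_left ?_)
      have : (m + 1) * (h + m) ≠ 0 := by positivity
      exact neg_ne_zero.mpr (by exact_mod_cast this)
  refine descend (d * n).toNat (eq_zero_of_biweight_large (hom _) ?_)
  have := Int.self_le_toNat (d * n)
  omega

open MvPolynomial in
theorem exists_D1_eq_of_iterate_eq_zero {d : ℕ} {n h : ℤ} (hh : h < 0) (m : ℕ)
    {p : MvPolynomial (Fin (d + 1)) ℂ} (hp : IsWeightedHomogeneous (biweight d) p (n, h))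
    (hm : (D1 d)^[m] p = 0) :
    ∃ x, IsWeightedHomogeneous (biweight d) x (n, h + 2) ∧ D1 d x = p := by
  induction m generalizing p with
  | zero => exact ⟨0, isWeightedHomogeneous_zero _ _ _, by rw [map_zero]; exact hm.symm⟩
  | succ m ih =>
    have hom (i : ℕ) : IsWeightedHomogeneous (biweight d) ((D1 d)^[i] p) (n, h - 2 * i) := by
      induction i with
      | zero => simpa using hp
      | succ i ih =>
        rw [Function.iterate_succ_apply']
        convert isWeightedHomogeneous_D1 ih using 2
        push_cast; ring
    have comm (i : ℕ) : (D1 d)^[i + 1] (raising d p) = raising d ((D1 d)^[i + 1] p) -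
        ((i + 1) * (h - i) : ℂ) • (D1 d)^[i] p := by
      induction i with
      | zero => simp [D1_raising hp]
      | succ i ih =>
        rw [Function.iterate_succ_apply', ih, map_sub, D1_raising (hom _), Derivation.map_smul,
          ← Function.iterate_succ_apply' (D1 d), ← Function.iterate_succ_apply' (D1 d), sub_sub,
          ← add_smul]
        congr 2
        push_cast; ring
    have hc : ((m + 1) * (h - m) : ℂ) ≠ 0 := by
      have : (m + 1) * (h - m) ≠ 0 := mul_ne_zero (by positivity) (by omega)
      exact_mod_cast this
    have hit (i : ℕ) (a b : MvPolynomial (Fin (d + 1)) ℂ) (c : ℂ) :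
        (D1 d)^[i] (a + c • b) = (D1 d)^[i] a + c • (D1 d)^[i] b := by
      induction i with
      | zero => rfl
      | succ i ih => simp only [Function.iterate_succ_apply', ih, map_add, Derivation.map_smul]
    set c : ℂ := ((m + 1) * (h - m) : ℂ)⁻¹ with hcdef
    have hF := isWeightedHomogeneous_raising hp
    have hEF := isWeightedHomogeneous_D1 hF
    rw [add_sub_cancel_right] at hEF
    obtain ⟨x, hx, hxp⟩ := ih (p := p + c • D1 d (raising d p))
      ((weightedHomogeneousSubmodule ℂ _ _).add_mem hp (Submodule.smul_mem _ _ hEF)) (by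
        rw [hit, ← Function.iterate_succ_apply, comm, hm, map_zero, zero_sub, smul_neg, smul_smul,
          inv_mul_cancel₀ hc, one_smul, add_neg_cancel])
    refine ⟨x - c • raising d p,
      (weightedHomogeneousSubmodule ℂ _ _).sub_mem hx (Submodule.smul_mem _ _ hF), ?_⟩
    rw [map_sub, hxp, Derivation.map_smul, add_sub_cancel_right]

/-- Monomials of degree `n` and weight at most `c`. -/
def lowWeight (d n : ℕ) (c : ℤ) : Set (Fin (d + 1) →₀ ℕ) :=
  {s | (Finsupp.weight (biweight d) s).1 = n ∧ (Finsupp.weight (biweight d) s).2 ≤ c}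

theorem weight_biweight_fst {d : ℕ} (s : Fin (d + 1) →₀ ℕ) :
    (Finsupp.weight (biweight d) s).1 = s.degree := by
  rw [Finsupp.weight_apply, Finsupp.sum, Prod.fst_sum, Finsupp.degree_apply]
  simp [biweight]

theorem finite_lowWeight (d n : ℕ) (c : ℤ) : (lowWeight d n c).Finite := by
  refine ((Finset.finsuppAntidiag Finset.univ n).finite_toSet).subset fun s hs => ?_
  have := hs.1
  rw [weight_biweight_fst] at this
  rw [Finset.mem_coe, Finset.mem_finsuppAntidiag]
  refine ⟨?_, Finset.subset_univ _⟩
  rw [← Finsupp.degree_eq_sum]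
  exact_mod_cast this

open MvPolynomial in
theorem iterate_D1_eq_zero {d : ℕ} {p : MvPolynomial (Fin (d + 1)) ℂ} {n h : ℤ}
    (hp : IsWeightedHomogeneous (biweight d) p (n, h)) : ∃ m, (D1 d)^[m] p = 0 := by
  have hom (i : ℕ) : IsWeightedHomogeneous (biweight d) ((D1 d)^[i] p) (n, h - 2 * i) := by
    induction i with
    | zero => simpa using hp
    | succ i ih =>
      rw [Function.iterate_succ_apply']
      convert isWeightedHomogeneous_D1 ih using 2
      push_cast; ring
  refine ⟨(d * n + h).toNat + 1, ?_⟩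
  ext s
  by_contra hs
  have := hom _ hs
  rw [Finsupp.weight_apply, Finsupp.sum, Prod.ext_iff, Prod.fst_sum, Prod.snd_sum] at this
  obtain ⟨h1, h2⟩ := this
  simp only at h1 h2
  have h3 : -(d * n) ≤ ∑ c ∈ s.support, (s c • biweight d c).2 := by
    rw [← h1, Finset.mul_sum, ← Finset.sum_neg_distrib]
    refine Finset.sum_le_sum fun i _ => ?_
    simp [biweight]
    nlinarith
  have := Int.self_le_toNat (d * n + h)
  push_cast at h2
  omega

open MvPolynomial in
theorem isWeightedHomogeneous_monomial_biweight {d : ℕ} (s : Fin (d + 1) →₀ ℕ) (r : ℂ) :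
    IsWeightedHomogeneous (biweight d) (monomial s r)
      ((Finsupp.weight (biweight d) s).1, (Finsupp.weight (biweight d) s).2) :=
  isWeightedHomogeneous_monomial _ s r rfl

open MvPolynomial in
theorem map_D1_restrictSupport (d n : ℕ) :
    (restrictSupport ℂ (lowWeight d n 0)).map (D1 d).toLinearMap =
      restrictSupport ℂ (lowWeight d n (-2)) := by
  apply le_antisymm
  · rw [restrictSupport_eq_span, Submodule.map_span_le]
    rintro _ ⟨s, hs, rfl⟩
    have := isWeightedHomogeneous_D1 (isWeightedHomogeneous_monomial_biweight s 1)
    rw [mem_restrictSupport_iff]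
    intro t ht
    have ht := this (mem_support_iff.mp ht)
    obtain ⟨h1, h2⟩ := hs
    refine ⟨by rw [ht]; exact h1, by rw [ht]; dsimp only; linarith⟩
  · rw [restrictSupport_eq_span (R := ℂ) (lowWeight d n (-2)), Submodule.span_le]
    rintro _ ⟨s, hs, rfl⟩
    have hom := isWeightedHomogeneous_monomial_biweight s 1
    obtain ⟨m, hm⟩ := iterate_D1_eq_zero hom
    have hs2 := hs.2
    obtain ⟨x, hx, hxs⟩ := exists_D1_eq_of_iterate_eq_zero (by omega) m hom hm
    refine ⟨x, fun t ht => ?_, hxs⟩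
    have ht := hx (mem_support_iff.mp ht)
    exact ⟨by rw [ht]; exact hs.1, by rw [ht]; dsimp only; linarith⟩

open MvPolynomial in
theorem weightedHomogeneousComponent_D1 {d : ℕ} (p : MvPolynomial (Fin (d + 1)) ℂ) (n h : ℤ) :
    weightedHomogeneousComponent (biweight d) (n, h - 2) (D1 d p) =
      D1 d (weightedHomogeneousComponent (biweight d) (n, h) p) := by
  induction p using MvPolynomial.induction_on' with
  | add p q hp hq => simp only [map_add, hp, hq]
  | monomial s r =>
    have hs := isWeightedHomogeneous_monomial_biweight s r
    rw [weightedHomogeneousComponent_of_mem hs,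
      weightedHomogeneousComponent_of_mem (isWeightedHomogeneous_D1 hs)]
    simp only [Prod.ext_iff, sub_left_inj]
    split_ifs <;> simp

open MvPolynomial in
theorem Sn_eq_inf (d n : ℕ) :
    Sn d n = restrictSupport ℂ (lowWeight d n 0) ⊓ LinearMap.ker (D1 d).toLinearMap := by
  ext p
  simp only [Sn, Submodule.mem_inf, LinearMap.mem_ker, Derivation.coeFn_coe,
    mem_homogeneousSubmodule, mem_restrictSupport_iff]
  refine and_congr_left fun hE => ⟨fun hp s hs => ?_, fun hp s hs => ?_⟩
  · have hs := mem_support_iff.mp hs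
    refine ⟨?_, not_lt.mp fun hlt => hs ?_⟩
    · rw [weight_biweight_fst, Finsupp.degree_eq_weight_one]
      exact_mod_cast hp hs
    · have hz := eq_zero_of_D1_eq_zero
        (weightedHomogeneousComponent_isWeightedHomogeneous (w := biweight d)
          ((Finsupp.weight (biweight d) s).1, (Finsupp.weight (biweight d) s).2) p) hlt
        (by rw [← weightedHomogeneousComponent_D1, hE, map_zero])
      have := coeff_weightedHomogeneousComponent (w := biweight d)
        (n := Finsupp.weight (biweight d) s) (φ := p) s
      rw [if_pos rfl] at this
      rw [← this]
      exact (congrArg (coeff s) hz).trans (coeff_zero s)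
  · have := (hp (mem_support_iff.mpr hs)).1
    rw [weight_biweight_fst] at this
    rw [Finsupp.degree_eq_weight_one] at this
    exact_mod_cast this

open MvPolynomial in
theorem finrank_restrictSupport {σ : Type*} (S : Set (σ →₀ ℕ)) :
    Module.finrank ℂ (restrictSupport ℂ S) = S.ncard := by
  rw [Module.finrank_eq_nat_card_basis (basisRestrictSupport ℂ S), Nat.card_coe_set_eq]

open MvPolynomial in
theorem finrank_Sn_add (d n : ℕ) :
    Module.finrank ℂ (Sn d n) + (lowWeight d n (-2)).ncard = (lowWeight d n 0).ncard := by
  have : Finite (lowWeight d n 0) := finite_lowWeight d n 0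
  have : Module.Finite ℂ (restrictSupport ℂ (lowWeight d n 0)) :=
    Module.Finite.of_basis (basisRestrictSupport ℂ (lowWeight d n 0))
  have h := LinearMap.finrank_range_add_finrank_ker
    ((D1 d).toLinearMap.domRestrict (restrictSupport ℂ (lowWeight d n 0)))
  rw [LinearMap.range_domRestrict, map_D1_restrictSupport, finrank_restrictSupport,
    finrank_restrictSupport] at h
  rw [← h, add_comm, Sn_eq_inf, LinearMap.ker_domRestrict, inf_comm,
    ← Submodule.finrank_map_subtype_eq, Submodule.map_comap_subtype, inf_comm]

theorem finrank_Sn (d n : ℕ) :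
    Module.finrank ℂ (Sn d n) = (lowWeight d n 0 \ lowWeight d n (-2)).ncard := by
  have hsub : lowWeight d n (-2) ⊆ lowWeight d n 0 := fun s hs => ⟨hs.1, by linarith [hs.2]⟩
  have := Set.ncard_sdiff_add_ncard_of_subset hsub (finite_lowWeight d n 0)
  have := finrank_Sn_add d n
  omega

theorem finrank_Sn_eight (n : ℕ) :
    Module.finrank ℂ (Sn 8 n) = ((Finset.finsuppAntidiag (Finset.univ : Finset (Fin 9)) n).filter
      fun s => ∑ i, (s i : ℤ) * (i.val - 4) = 0).card := by
  rw [finrank_Sn, ← Set.ncard_coe_finset]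
  congr 1
  ext s
  have hsnd : (Finsupp.weight (biweight 8) s).2 = 2 * ∑ i, (s i : ℤ) * (i.val - 4) := by
    rw [Finsupp.weight_apply, Finsupp.sum_fintype _ _ (by simp), Prod.snd_sum, Finset.mul_sum]
    refine Finset.sum_congr rfl fun i _ => ?_
    simp [biweight]
    ring
  simp only [lowWeight, Set.mem_sdiff, Set.mem_ofPred_eq, hsnd, weight_biweight_fst,
    Finset.coe_filter, Finset.mem_finsuppAntidiag, Finset.subset_univ, and_true, Nat.cast_inj,
    ← Finsupp.degree_eq_sum, Nat.reduceAdd]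
  constructor
  · rintro ⟨⟨h1, h2⟩, h3⟩
    exact ⟨h1, by by_contra h; exact h3 ⟨h1, by omega⟩⟩
  · rintro ⟨h1, h2⟩
    exact ⟨⟨h1, by omega⟩, fun h => by omega⟩

/-- Horner evaluation of the polynomial with the given coefficients (constant term first). -/
def hornerEval {R : Type*} [Ring R] (z : R) (l : List R) : R :=
  l.foldr (fun c s => c + z * s) 0

/-- Evaluation at `(q, z)` of the bivariate polynomial whose coefficient list in `q` consists of
coefficient lists in `z`. -/
def hornerEval₂ {R : Type*} [Ring R] (q z : R) (l : List (List ℤ)) : R :=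
  hornerEval q (l.map fun c => hornerEval z (c.map fun n : ℤ => (n : R)))

/-- Coefficients in `q` and then in `z` of the numerator of the part with positive powers of `q`
in `octavic_partialFractions`. -/
def positiveNumerator : List (List ℤ) :=
  [ [0, 1, 3, 6, 11, 18, 25, 32, 36, 38, 36, 32, 25, 18, 11, 6, 3, 1],
    [0, 1, 2, 3, 5, 6, 7, 7, 5, 2, -1, -4, -7, -8, -7, -5, -3, -2, -1],
    [0, 1, 0, 0, -1, -4, -9, -18, -28, -35, -40, -41, -38, -32, -24, -16, -10, -5, -2],
    [0, 1, -1, -2, -4, -9, -16, -26, -34, -39, -41, -39, -34, -26, -17, -10, -5, -1, 0, 1],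
    [0, 0, -2, -2, -6, -14, -25, -35, -40, -42, -41, -38, -31, -20, -10, -3, 1, 2, 2, 2],
    [0, 0, -1, 0, -2, -3, -1, 3, 11, 20, 29, 37, 43, 44, 40, 32, 23, 15, 8, 4],
    [0, 0, -1, 1, 0, 1, 4, 9, 18, 26, 33, 39, 42, 40, 34, 24, 16, 10, 5, 2, -1],
    [0, 0, 0, 1, 1, 4, 9, 17, 26, 33, 38, 40, 39, 34, 26, 18, 12, 6, 1, -1, -2],
    [0, 0, 0, 1, 0, 1, 3, 6, 8, 7, 6, 4, 2, -2, -5, -7, -6, -6, -5, -4, -3],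
    [0, 0, 0, 0, -1, 0, -2, -6, -12, -19, -25, -31, -36, -38, -36, -31, -25, -19, -12, -6,
      -2, 0, -1]]

set_option maxHeartbeats 8000000 in
set_option maxRecDepth 100000 in
theorem octavic_polynomial_identity {R : Type*} [CommRing R] (q z : R) :
    q ^ 10 * ((1 - z ^ 2) ^ 2 * (1 - z ^ 3) ^ 2 * (1 - z ^ 4) * (1 - z ^ 5) * (1 - z ^ 7)) =
      (1 + 2 * z ^ 2 + 6 * z ^ 3 + 12 * z ^ 4 + 19 * z ^ 5 + 25 * z ^ 6 + 31 * z ^ 7 + 36 * z ^ 8 +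
        38 * z ^ 9 + 36 * z ^ 10 + 31 * z ^ 11 + 25 * z ^ 12 + 19 * z ^ 13 + 12 * z ^ 14 + 6 * z ^ 15 + 2 * z ^ 16 + z ^ 18) *
        (((1 - q * z) * (1 - q ^ 2 * z) * (1 - q ^ 3 * z) * (1 - q ^ 4 * z)) *
          ((q - z) * (q ^ 2 - z) * (q ^ 3 - z) * (q ^ 4 - z))) +
      q * hornerEval₂ q z positiveNumerator *
        ((q - z) * (q ^ 2 - z) * (q ^ 3 - z) * (q ^ 4 - z)) +
      hornerEval₂ q z positiveNumerator.reverse *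
        ((1 - q * z) * (1 - q ^ 2 * z) * (1 - q ^ 3 * z) * (1 - q ^ 4 * z)) := by
  simp only [hornerEval₂, hornerEval, positiveNumerator, List.reverse_cons, List.reverse_nil,
    List.nil_append, List.cons_append, List.map_cons, List.map_nil, List.foldr_cons,
    List.foldr_nil, Int.cast_ofNat, Int.cast_neg, Int.cast_zero, Int.cast_one, mul_zero, add_zero,
    zero_add]
  ring

open LaurentPolynomial in
/-- The power series of constant terms of a power series with Laurent polynomial coefficients. -/
noncomputable def constTerm : PowerSeries ℂ[T;T⁻¹] →+ PowerSeries ℂ where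
  toFun f := PowerSeries.mk fun n => (PowerSeries.coeff n f).coeff 0
  map_zero' := by ext; simp
  map_add' f g := by ext; simp

open LaurentPolynomial in
theorem coeff_constTerm (f : PowerSeries ℂ[T;T⁻¹]) (n : ℕ) :
    PowerSeries.coeff n (constTerm f) = (PowerSeries.coeff n f).coeff 0 := by
  simp [constTerm]

open LaurentPolynomial in
theorem constTerm_map_mul (g : PowerSeries ℂ) (f : PowerSeries ℂ[T;T⁻¹]) :
    constTerm (PowerSeries.map LaurentPolynomial.C g * f) = g * constTerm f := by
  ext n
  simp only [coeff_constTerm, PowerSeries.coeff_mul, PowerSeries.coeff_map,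
    AddMonoidAlgebra.coeff_sum, Finsupp.finsetSum_apply]
  refine Finset.sum_congr rfl fun x _ => ?_
  rw [← LaurentPolynomial.smul_eq_C_mul]
  simp

open LaurentPolynomial in
theorem constTerm_map (g : PowerSeries ℂ) :
    constTerm (PowerSeries.map LaurentPolynomial.C g) = g := by
  ext n
  simp [coeff_constTerm]

open LaurentPolynomial in
theorem coeff_zero_toLaurent_X_mul (f : Polynomial ℂ) :
    (Polynomial.toLaurent (Polynomial.X * f)).coeff 0 = 0 := by
  induction f using Polynomial.induction_on' with
  | add f g hf hg => simp only [mul_add, map_add, AddMonoidAlgebra.coeff_add, Finsupp.add_apply,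
      hf, hg, add_zero]
  | monomial n r =>
    rw [Polynomial.X_mul_monomial, Polynomial.toLaurent_C_mul_T, ← LaurentPolynomial.smul_eq_C_mul]
    simp
    omega

open LaurentPolynomial in
/-- A quotient whose expansion only involves exponents of one sign has no constant term. -/
theorem constTerm_eq_zero (φ : Polynomial ℂ →+* ℂ[T;T⁻¹])
    (hφ : ∀ f, (φ (Polynomial.X * f)).coeff 0 = 0) (a p : PowerSeries (Polynomial ℂ))
    (hp : PowerSeries.constantCoeff p = 1) (G : PowerSeries ℂ[T;T⁻¹])
    (hG : PowerSeries.map φ p * G =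
      PowerSeries.C (φ Polynomial.X) * PowerSeries.map φ a) : constTerm G = 0 := by
  obtain ⟨r, hr⟩ : ∃ r, p * r = 1 :=
    ⟨PowerSeries.invOfUnit p 1, PowerSeries.mul_invOfUnit p 1 (by simpa using hp)⟩
  have hG' : G = PowerSeries.C (φ Polynomial.X) * PowerSeries.map φ (a * r) := by
    have h1 : PowerSeries.map φ p * PowerSeries.map φ r = 1 := by rw [← map_mul, hr, map_one]
    rw [map_mul]
    linear_combination PowerSeries.map φ r * hG - G * h1
  ext n
  rw [coeff_constTerm, hG', PowerSeries.coeff_C_mul, PowerSeries.coeff_map, ← map_mul, hφ]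
  simp

theorem map_hornerEval {R S : Type*} [Ring R] [Ring S] (f : R →+* S) (z : R) (l : List R) :
    f (hornerEval z l) = hornerEval (f z) (l.map f) := by
  induction l with
  | nil => simp [hornerEval]
  | cons c l ih =>
    simp only [hornerEval] at ih
    simp [hornerEval, ih]

theorem map_hornerEval₂ {R S : Type*} [Ring R] [Ring S] (f : R →+* S) (q z : R)
    (l : List (List ℤ)) : f (hornerEval₂ q z l) = hornerEval₂ (f q) (f z) l := by
  simp only [hornerEval₂, map_hornerEval, List.map_map]
  congr 2
  ext c
  simp [map_hornerEval, Function.comp_def]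

theorem hornerEval_append {R : Type*} [CommRing R] (z : R) (l m : List R) :
    hornerEval z (l ++ m) = hornerEval z l + z ^ l.length * hornerEval z m := by
  induction l with
  | nil => simp [hornerEval]
  | cons c l ih =>
    simp only [hornerEval] at ih
    simp only [hornerEval, List.cons_append, List.foldr_cons, ih, List.length_cons]
    ring

theorem mul_hornerEval_eq_reverse {R : Type*} [CommRing R] {q q' : R} (h : q * q' = 1)
    (l : List R) : q' * hornerEval q' l = q' ^ l.length * hornerEval q l.reverse := by
  induction l with
  | nil => simp [hornerEval]
  | cons c l ih =>
    have h1 : q' ^ l.length * q ^ l.length = 1 := by rw [← mul_pow, mul_comm, h, one_pow]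
    have h2 : hornerEval q' (c :: l) = c + q' * hornerEval q' l := rfl
    have h3 : hornerEval q [c] = c := by simp [hornerEval]
    rw [h2, ih, List.reverse_cons, hornerEval_append, h3, List.length_reverse, List.length_cons]
    linear_combination -q' * c * h1

/-- The partial fraction decomposition of `1 / ∏ (1 - q ^ w * z)`, `0 < |w| ≤ 4`, separating
positive and negative powers of `q`. -/
theorem octavic_partialFractions {R : Type*} [CommRing R] {q q' z : R} (h : q * q' = 1) :
    (1 - z ^ 2) ^ 2 * (1 - z ^ 3) ^ 2 * (1 - z ^ 4) * (1 - z ^ 5) * (1 - z ^ 7) =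
      (1 + 2 * z ^ 2 + 6 * z ^ 3 + 12 * z ^ 4 + 19 * z ^ 5 + 25 * z ^ 6 + 31 * z ^ 7 + 36 * z ^ 8 +
        38 * z ^ 9 + 36 * z ^ 10 + 31 * z ^ 11 + 25 * z ^ 12 + 19 * z ^ 13 + 12 * z ^ 14 + 6 * z ^ 15 + 2 * z ^ 16 + z ^ 18) *
        (((1 - q * z) * (1 - q ^ 2 * z) * (1 - q ^ 3 * z) * (1 - q ^ 4 * z)) *
          ((1 - q' * z) * (1 - q' ^ 2 * z) * (1 - q' ^ 3 * z) * (1 - q' ^ 4 * z))) +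
      q * hornerEval₂ q z positiveNumerator *
        ((1 - q' * z) * (1 - q' ^ 2 * z) * (1 - q' ^ 3 * z) * (1 - q' ^ 4 * z)) +
      q' * hornerEval₂ q' z positiveNumerator *
        ((1 - q * z) * (1 - q ^ 2 * z) * (1 - q ^ 3 * z) * (1 - q ^ 4 * z)) := by
  have hrev : q' * hornerEval₂ q' z positiveNumerator =
      q' ^ 10 * hornerEval₂ q z positiveNumerator.reverse := by
    simp only [hornerEval₂, mul_hornerEval_eq_reverse h, List.map_reverse]
    simp [positiveNumerator]
  have hpow (n : ℕ) : 1 - q' ^ n * z = q' ^ n * (q ^ n - z) := by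
    have : q' ^ n * q ^ n = 1 := by rw [← mul_pow, mul_comm, h, one_pow]
    linear_combination -this
  have h1 : 1 - q' * z = q' * (q - z) := by simpa using hpow 1
  have h10 : q' ^ 10 * q ^ 10 = 1 := by rw [← mul_pow, mul_comm, h, one_pow]
  rw [hrev, h1, hpow 2, hpow 3, hpow 4]
  linear_combination q' ^ 10 * octavic_polynomial_identity q z -
    ((1 - z ^ 2) ^ 2 * (1 - z ^ 3) ^ 2 * (1 - z ^ 4) * (1 - z ^ 5) * (1 - z ^ 7)) * h10

open LaurentPolynomial PowerSeries in
theorem constTerm_mul_denominator (F : PowerSeries ℂ[T;T⁻¹])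
    (hF : (∏ i : Fin 9, (1 - PowerSeries.C (T ((i : ℤ) - 4)) * PowerSeries.X)) * F = 1) :
    constTerm F * ((1 - X) * (1 - X ^ 2) ^ 2 * (1 - X ^ 3) ^ 2 * (1 - X ^ 4) * (1 - X ^ 5) *
      (1 - X ^ 7)) = (1 + 2 * X ^ 2 + 6 * X ^ 3 + 12 * X ^ 4 + 19 * X ^ 5 + 25 * X ^ 6 + 31 * X ^ 7 + 36 * X ^ 8 +
      38 * X ^ 9 + 36 * X ^ 10 + 31 * X ^ 11 + 25 * X ^ 12 + 19 * X ^ 13 + 12 * X ^ 14 + 6 * X ^ 15 + 2 * X ^ 16 + X ^ 18) := by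
  set q : PowerSeries ℂ[T;T⁻¹] := PowerSeries.C (T 1) with hq
  set q' : PowerSeries ℂ[T;T⁻¹] := PowerSeries.C (T (-1)) with hq'
  set z : PowerSeries ℂ[T;T⁻¹] := PowerSeries.X with hz
  have hqq : q * q' = 1 := by rw [hq, hq', ← map_mul, ← T_add]; simp
  set P := (1 - q * z) * (1 - q ^ 2 * z) * (1 - q ^ 3 * z) * (1 - q ^ 4 * z) with hP
  set M := (1 - q' * z) * (1 - q' ^ 2 * z) * (1 - q' ^ 3 * z) * (1 - q' ^ 4 * z) with hM
  set G := (1 - z) * F with hGdef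
  have hprod : P * M * G = 1 := by
    rw [← hF]
    simp only [Fin.prod_univ_succ, hP, hM, hGdef, hq, hq', ← map_pow, T_pow]
    simp
    ring
  have hpos : constTerm (q * hornerEval₂ q z positiveNumerator * (M * G)) = 0 := by
    refine constTerm_eq_zero Polynomial.toLaurent ?_
      (hornerEval₂ (PowerSeries.C Polynomial.X) PowerSeries.X positiveNumerator)
      ((1 - PowerSeries.C Polynomial.X * PowerSeries.X) *
        (1 - PowerSeries.C Polynomial.X ^ 2 * PowerSeries.X) *
        (1 - PowerSeries.C Polynomial.X ^ 3 * PowerSeries.X) *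
        (1 - PowerSeries.C Polynomial.X ^ 4 * PowerSeries.X)) ?_ _ ?_
    · exact coeff_zero_toLaurent_X_mul
    · simp
    · simp only [map_hornerEval₂, map_mul, map_sub, map_pow, map_one, PowerSeries.map_C,
        PowerSeries.map_X, Polynomial.toLaurent_X]
      simp only [← hq, ← hz, ← hP]
      linear_combination q * hornerEval₂ q z positiveNumerator * hprod
  have hneg : constTerm (q' * hornerEval₂ q' z positiveNumerator * (P * G)) = 0 := by
    refine constTerm_eq_zero ((invert (R := ℂ)).toRingHom.comp Polynomial.toLaurent) ?_
      (hornerEval₂ (PowerSeries.C Polynomial.X) PowerSeries.X positiveNumerator)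
      ((1 - PowerSeries.C Polynomial.X * PowerSeries.X) *
        (1 - PowerSeries.C Polynomial.X ^ 2 * PowerSeries.X) *
        (1 - PowerSeries.C Polynomial.X ^ 3 * PowerSeries.X) *
        (1 - PowerSeries.C Polynomial.X ^ 4 * PowerSeries.X)) ?_ _ ?_
    · intro f
      change (invert (Polynomial.toLaurent (Polynomial.X * f))).coeff 0 = 0
      rw [invert_apply, neg_zero, coeff_zero_toLaurent_X_mul]
    · simp
    · have hX : ((invert (R := ℂ)).toRingHom.comp Polynomial.toLaurent) Polynomial.X = T (-1) := by
        simp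
      simp only [map_hornerEval₂, map_mul, map_sub, map_pow, map_one, PowerSeries.map_C,
        PowerSeries.map_X, hX]
      simp only [← hq', ← hz, ← hM]
      linear_combination q' * hornerEval₂ q' z positiveNumerator * hprod
  have hmain : PowerSeries.map LaurentPolynomial.C ((1 - X) * (1 - X ^ 2) ^ 2 * (1 - X ^ 3) ^ 2 *
      (1 - X ^ 4) * (1 - X ^ 5) * (1 - X ^ 7)) * F =
      PowerSeries.map LaurentPolynomial.C ((1 + 2 * X ^ 2 + 6 * X ^ 3 + 12 * X ^ 4 + 19 * X ^ 5 + 25 * X ^ 6 + 31 * X ^ 7 + 36 * X ^ 8 +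
      38 * X ^ 9 + 36 * X ^ 10 + 31 * X ^ 11 + 25 * X ^ 12 + 19 * X ^ 13 + 12 * X ^ 14 + 6 * X ^ 15 + 2 * X ^ 16 + X ^ 18)) +
      q * hornerEval₂ q z positiveNumerator * (M * G) +
      q' * hornerEval₂ q' z positiveNumerator * (P * G) := by
    simp only [map_mul, map_add, map_sub, map_pow, map_one, map_ofNat, PowerSeries.map_X, ← hz]
    linear_combination G * octavic_partialFractions (z := z) hqq + ((1 + 2 * z ^ 2 + 6 * z ^ 3 + 12 * z ^ 4 + 19 * z ^ 5 + 25 * z ^ 6 + 31 * z ^ 7 + 36 * z ^ 8 +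
        38 * z ^ 9 + 36 * z ^ 10 + 31 * z ^ 11 + 25 * z ^ 12 + 19 * z ^ 13 + 12 * z ^ 14 + 6 * z ^ 15 + 2 * z ^ 16 + z ^ 18)) * hprod
  have := congrArg constTerm hmain
  rw [map_add, map_add, hpos, hneg, constTerm_map_mul, constTerm_map, add_zero, add_zero] at this
  rw [mul_comm, this]

open LaurentPolynomial in
theorem PSeries_eight_eq_constTerm : PSeries 8 = constTerm
    (∏ i : Fin 9, PowerSeries.mk fun n => (T ((i : ℤ) - 4) : ℂ[T;T⁻¹]) ^ n) := by
  ext n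
  rw [PSeries, PowerSeries.coeff_mk, finrank_Sn_eight, coeff_constTerm, PowerSeries.coeff_prod,
    AddMonoidAlgebra.coeff_sum, Finsupp.finsetSum_apply, Finset.card_filter, Nat.cast_sum]
  refine Finset.sum_congr rfl fun s _ => ?_
  have hT (t : Finset (Fin 9)) : ∏ i ∈ t, (T ((s i : ℤ) * ((i : ℤ) - 4)) : ℂ[T;T⁻¹]) =
      T (∑ i ∈ t, (s i : ℤ) * ((i : ℤ) - 4)) := by
    induction t using Finset.cons_induction with
    | empty => simp
    | cons a t ha ih => rw [Finset.prod_cons, Finset.sum_cons, ih, T_add]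
  simp only [PowerSeries.coeff_mk, T_pow, hT, T_apply]
  split_ifs <;> simp

theorem mk_pow_mul_eq_one {R : Type*} [CommRing R] (a : R) :
    (1 - PowerSeries.C a * PowerSeries.X) * PowerSeries.mk (fun n => a ^ n) = 1 := by
  ext n
  rw [sub_mul, one_mul, mul_assoc, map_sub, PowerSeries.coeff_C_mul, PowerSeries.coeff_mk,
    PowerSeries.coeff_one]
  cases n with
  | zero => simp
  | succ n => simp [PowerSeries.coeff_succ_X_mul, pow_succ']

/-- The Poincaré series of the algebra of covariants of the binary 8-form. -/
theorem poincare_series_d8 :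
    PSeries 8 = (1 + 2 * (PowerSeries.X : PowerSeries ℂ) ^ 2 + 6 * (PowerSeries.X : PowerSeries ℂ) ^ 3 + 12 * (PowerSeries.X : PowerSeries ℂ) ^ 4 + 19 * (PowerSeries.X : PowerSeries ℂ) ^ 5 + 25 * (PowerSeries.X : PowerSeries ℂ) ^ 6 + 31 * (PowerSeries.X : PowerSeries ℂ) ^ 7 + 36 * (PowerSeries.X : PowerSeries ℂ) ^ 8 + 38 * (PowerSeries.X : PowerSeries ℂ) ^ 9 + 36 * (PowerSeries.X : PowerSeries ℂ) ^ 10 + 31 * (PowerSeries.X : PowerSeries ℂ) ^ 11 + 25 * (PowerSeries.X : PowerSeries ℂ) ^ 12 + 19 * (PowerSeries.X : PowerSeries ℂ) ^ 13 + 12 * (PowerSeries.X : PowerSeries ℂ) ^ 14 + 6 * (PowerSeries.X : PowerSeries ℂ) ^ 15 + 2 * (PowerSeries.X : PowerSeries ℂ) ^ 16 + (PowerSeries.X : PowerSeries ℂ) ^ 18) * ((1 - (PowerSeries.X : PowerSeries ℂ)) * (1 - (PowerSeries.X : PowerSeries ℂ) ^ 2) ^ 2 * (1 - (PowerSeries.X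 : PowerSeries ℂ) ^ 3) ^ 2 * (1 - (PowerSeries.X : PowerSeries ℂ) ^ 4) * (1 - (PowerSeries.X : PowerSeries ℂ) ^ 5) * (1 - (PowerSeries.X : PowerSeries ℂ) ^ 7))⁻¹ := by
  rw [PowerSeries.eq_mul_inv_iff_mul_eq (by simp), PSeries_eight_eq_constTerm,
    constTerm_mul_denominator _ (by
      rw [← Finset.prod_mul_distrib]
      exact Finset.prod_eq_one fun i _ => mk_pow_mul_eq_one _)]

end
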